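/- Let A be a unital C*-algebra, a ∈ A, and let (a_n) be a sequence of group invertible elements of A converging in norm to a. The following statements are equivalent: (i) a is group invertible and (a_n#) converges to a#; (ii) the sequence (a_n#) is bounded; (iii) a is Moore-Penrose invertible, (a_n†) converges to a†, and the sequence (a_n#·a_n) is bounded; (iv) a is Moore-Penrose invertible, (a_n†) converges to a†, and there exists ψ ∈ [0, π/2) such that ψ_{a_n} ≤ ψ for all n. -/

import Mathlib

open scoped Classical

/-- `x` is a Moore–Penrose inverse of `a`. -/
def IsMPInv {A : Type*} [Ring A] [StarRing A] (a x : A) : Prop :=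
  a * x * a = a ∧ x * a * x = x ∧ star (a * x) = a * x ∧ star (x * a) = x * a

/-- `x` is a group inverse of `a`. -/
def IsGroupInv {A : Type*} [Ring A] (a x : A) : Prop :=
  a * x * a = a ∧ x * a * x = x ∧ a * x = x * a

/-- `x` is a core inverse of `a`: `a·x·a = a`, `x·A = a·A`, `A·x = A·a*`. -/
def IsCoreInv {A : Type*} [Ring A] [StarRing A] (a x : A) : Prop :=
  a * x * a = a ∧ (Set.range fun y => x * y) = (Set.range fun y => a * y) ∧
    (Set.range fun y => y * x) = (Set.range fun y => y * star a)

/-- `x` is a dual core inverse of `a`: `a·x·a = a`, `x·A = a*·A`, `A·x = A·a`. -/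
def IsDualCoreInv {A : Type*} [Ring A] [StarRing A] (a x : A) : Prop :=
  a * x * a = a ∧ (Set.range fun y => x * y) = (Set.range fun y => star a * y) ∧
    (Set.range fun y => y * x) = (Set.range fun y => y * a)

/-- The Moore–Penrose inverse `a†` (or `0` if it does not exist). -/
noncomputable def mpInv {A : Type*} [Ring A] [StarRing A] (a : A) : A :=
  if h : ∃ x, IsMPInv a x then h.choose else 0

/-- The group inverse `a#` (or `0` if it does not exist). -/
noncomputable def groupInv {A : Type*} [Ring A] (a : A) : A :=
  if h : ∃ x, IsGroupInv a x then h.choose else 0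

/-- The core inverse `a⊕` (or `0` if it does not exist). -/
noncomputable def coreInv {A : Type*} [Ring A] [StarRing A] (a : A) : A :=
  if h : ∃ x, IsCoreInv a x then h.choose else 0

/-- The dual core inverse `a⊖` (or `0` if it does not exist). -/
noncomputable def dualCoreInv {A : Type*} [Ring A] [StarRing A] (a : A) : A :=
  if h : ∃ x, IsDualCoreInv a x then h.choose else 0

/-- The maximal angle `ψ_a ∈ [0, π/2]` between `a·a†` and `a†·a`, defined by
`sin ψ_a = ‖a·a† − a†·a‖` (and `ψ_a = 0` when `a = 0`). -/
noncomputable def maxAngle {A : Type*} [NormedRing A] [StarRing A] (a : A) : ℝ :=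
  Real.arcsin ‖a * mpInv a - mpInv a * a‖

/-- `δ(M, N)`: zero if `M = {0}`, otherwise the supremum of distances from
norm-one elements of `M` to `N`. -/
noncomputable def subDelta {E : Type*} [NormedAddCommGroup E] (M N : Set E) : ℝ :=
  if M = {0} then 0
  else sSup ((fun m => Metric.infDist m N) '' {m ∈ M | ‖m‖ = 1})

/-- The gap `θ(M, N)` between the subspaces `M` and `N`. -/
noncomputable def subGap {E : Type*} [NormedAddCommGroup E] (M N : Set E) : ℝ :=
  max (subDelta M N) (subDelta N M)

/-- The right ideal `a·A`. -/
def rIdeal {A : Type*} [Ring A] (a : A) : Set A := Set.range fun y => a * y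

/-- The left ideal `A·a`. -/
def lIdeal {A : Type*} [Ring A] (a : A) : Set A := Set.range fun y => y * a

/-- The right annihilator `a° = {x : a·x = 0}`. -/
def rAnn {A : Type*} [Ring A] (a : A) : Set A := {x | a * x = 0}

/-- The left annihilator `°a = {x : x·a = 0}`. -/
def lAnn {A : Type*} [Ring A] (a : A) : Set A := {x | x * a = 0}

open Filter Topology

section Uniqueness

variable {A : Type*} [Ring A]

theorem IsGroupInv.unique {a x y : A} (hx : IsGroupInv a x) (hy : IsGroupInv a y) : x = y := by
  obtain ⟨hx₁, hx₂, hx₃⟩ := hx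
  obtain ⟨hy₁, hy₂, hy₃⟩ := hy
  have h : a * x = a * y := by
    calc a * x = x * a := hx₃
      _ = x * (a * y * a) := by rw [hy₁]
      _ = (x * a) * (y * a) := by noncomm_ring
      _ = (a * x) * (a * y) := by rw [← hx₃, ← hy₃]
      _ = (a * x * a) * y := by noncomm_ring
      _ = a * y := by rw [hx₁]
  calc x = x * a * x := hx₂.symm
    _ = a * x * x := by rw [hx₃]
    _ = y * (a * x) := by rw [← mul_assoc, ← hy₃, ← h]
    _ = y := by rw [h, ← mul_assoc, hy₂]

theorem IsMPInv.unique [StarRing A] {a x y : A} (hx : IsMPInv a x) (hy : IsMPInv a y) :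
    x = y := by
  obtain ⟨hx₁, hx₂, hx₃, hx₄⟩ := hx
  obtain ⟨hy₁, hy₂, hy₃, hy₄⟩ := hy
  have h : a * x = a * y := by
    calc a * x = star (a * x) := hx₃.symm
      _ = star ((a * y) * (a * x)) := by rw [← mul_assoc, hy₁]
      _ = a * x * (a * y) := by rw [star_mul, hx₃, hy₃]
      _ = a * y := by rw [← mul_assoc, hx₁]
  have h' : x * a = y * a := by
    calc x * a = star (x * a) := hx₄.symm
      _ = star ((x * a) * (y * a)) := by rw [mul_assoc, ← mul_assoc a, hy₁]
      _ = y * a * (x * a) := by rw [star_mul, hx₄, hy₄]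
      _ = y * a := by rw [mul_assoc, ← mul_assoc a, hx₁]
  calc x = x * a * x := hx₂.symm
    _ = y * a * y := by rw [h', mul_assoc, h, mul_assoc]
    _ = y := hy₂

theorem groupInv_spec {a : A} (h : ∃ x, IsGroupInv a x) : IsGroupInv a (groupInv a) := by
  rw [groupInv, dif_pos h]
  exact h.choose_spec

theorem IsGroupInv.groupInv_eq {a x : A} (h : IsGroupInv a x) : groupInv a = x :=
  (groupInv_spec ⟨x, h⟩).unique h

theorem IsMPInv.mpInv_eq [StarRing A] {a x : A} (h : IsMPInv a x) : mpInv a = x := by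
  have h' : ∃ x, IsMPInv a x := ⟨x, h⟩
  rw [mpInv, dif_pos h']
  exact h'.choose_spec.unique h

/-- The difference of two group inverses factors through the difference of the elements. -/
theorem IsGroupInv.sub_eq {a b x y : A} (hx : IsGroupInv a x) (hy : IsGroupInv b y) :
    y - x = y * y * (b - a) * (1 - a * x) + (1 - b * y) * (b - a) * (x * x)
      - y * (b - a) * x := by
  obtain ⟨hx₁, hx₂, hx₃⟩ := hx
  obtain ⟨hy₁, hy₂, hy₃⟩ := hy
  have h₁ : y * y * b = y := by rw [mul_assoc, ← hy₃, ← mul_assoc, hy₂]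
  have h₂ : a * (x * x) = x := by rw [← mul_assoc, hx₃, hx₂]
  have h₃ : (1 - b * y) * b = 0 := by rw [sub_mul, hy₁, one_mul, sub_self]
  have h₄ : a * (1 - a * x) = 0 := by rw [mul_sub, hx₃, ← mul_assoc, hx₁, mul_one, sub_self]
  have h₅ : y * y * (b - a) * (1 - a * x) = y * (1 - a * x) := by
    rw [mul_sub (y * y), sub_mul, h₁, mul_assoc (y * y), h₄, mul_zero, sub_zero]
  have h₆ : (1 - b * y) * (b - a) * (x * x) = -((1 - b * y) * x) := by
    rw [mul_sub (1 - b * y), sub_mul, h₃, zero_mul, mul_assoc, h₂, zero_sub]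
  rw [h₅, h₆, hy₃]
  noncomm_ring

theorem IsGroupInv.isIdempotentElem {a x : A} (h : IsGroupInv a x) :
    IsIdempotentElem (a * x) := by
  rw [IsIdempotentElem, ← mul_assoc, h.1]

end Uniqueness

section Projections

variable {A : Type*} [CStarAlgebra A]

/-- The orthogonal projection onto the range of an idempotent `e`. -/
noncomputable def rangeProj (e : A) : A := e * Ring.inverse (e + star e - 1)

/-- The orthogonal projection onto the orthogonal complement of the kernel of an
idempotent `e`. -/
noncomputable def coKerProj (e : A) : A := Ring.inverse (e + star e - 1) * e

variable {e : A}

theorem isUnit_add_star_sub_one (he : IsIdempotentElem e) : IsUnit (e + star e - 1) := by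
  have he' : star e * star e = star e := by rw [← star_mul, he.eq]
  have h : IsUnit (1 + star (e - star e) * (e - star e)) := by
    by_contra hu
    have hmem : (-1 : ℝ) ∈ spectrum ℝ (star (e - star e) * (e - star e)) := by
      rw [spectrum.mem_iff]
      intro hu'
      apply hu
      have := hu'.neg
      rwa [map_neg, map_one, neg_sub, sub_neg_eq_add, add_comm] at this
    linarith [spectrum_star_mul_self_nonneg _ hmem]
  have hsq : (e + star e - 1) * (e + star e - 1) =
      1 + star (e - star e) * (e - star e) := by
    simp only [star_sub, star_star, mul_sub, sub_mul, mul_add, add_mul, he.eq, he', mul_one,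
      one_mul]
    abel
  rw [← hsq] at h
  exact (Commute.refl _).isUnit_mul_iff.1 h |>.1

theorem mul_rangeProj (he : IsIdempotentElem e) : e * rangeProj e = rangeProj e := by
  rw [rangeProj, ← mul_assoc, he.eq]

theorem coKerProj_mul (he : IsIdempotentElem e) : coKerProj e * e = coKerProj e := by
  rw [coKerProj, mul_assoc, he.eq]

theorem inverse_mul_star (he : IsIdempotentElem e) :
    Ring.inverse (e + star e - 1) * star e = rangeProj e := by
  have hu := isUnit_add_star_sub_one he
  have he' : star e * star e = star e := by rw [← star_mul, he.eq]
  have h : star e * (e + star e - 1) = (e + star e - 1) * e := by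
    simp only [mul_sub, sub_mul, mul_add, add_mul, he.eq, he', mul_one, one_mul]
    abel
  apply hu.mul_right_cancel
  rw [mul_assoc, h, ← mul_assoc, Ring.inverse_mul_cancel _ hu, one_mul, rangeProj, mul_assoc,
    Ring.inverse_mul_cancel _ hu, mul_one]

theorem star_mul_inverse (he : IsIdempotentElem e) :
    star e * Ring.inverse (e + star e - 1) = coKerProj e := by
  have hu := isUnit_add_star_sub_one he
  have he' : star e * star e = star e := by rw [← star_mul, he.eq]
  have h : (e + star e - 1) * star e = e * (e + star e - 1) := by
    simp only [mul_sub, sub_mul, mul_add, add_mul, he.eq, he', mul_one, one_mul]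
    abel
  apply hu.mul_left_cancel
  rw [← mul_assoc, h, mul_assoc, Ring.mul_inverse_cancel _ hu, mul_one, coKerProj, ← mul_assoc,
    Ring.mul_inverse_cancel _ hu, one_mul]

theorem star_inverse_add_star_sub_one (e : A) :
    star (Ring.inverse (e + star e - 1)) = Ring.inverse (e + star e - 1) := by
  rw [← Ring.inverse_star]
  congr 1
  simp [add_comm]

theorem star_rangeProj (he : IsIdempotentElem e) : star (rangeProj e) = rangeProj e := by
  conv_lhs => rw [rangeProj, star_mul, star_inverse_add_star_sub_one, inverse_mul_star he]

theorem star_coKerProj (he : IsIdempotentElem e) : star (coKerProj e) = coKerProj e := by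
  conv_lhs => rw [coKerProj, star_mul, star_inverse_add_star_sub_one, star_mul_inverse he]

theorem mul_inverse_mul (he : IsIdempotentElem e) :
    e * Ring.inverse (e + star e - 1) * e = e := by
  have hu := isUnit_add_star_sub_one he
  have h : star e * e = (e + star e - 1) * e := by
    simp only [sub_mul, add_mul, he.eq, one_mul]
    abel
  change rangeProj e * e = e
  rw [← inverse_mul_star he, mul_assoc, h, ← mul_assoc, Ring.inverse_mul_cancel _ hu, one_mul]

theorem rangeProj_mul (he : IsIdempotentElem e) : rangeProj e * e = e := mul_inverse_mul he

theorem mul_coKerProj (he : IsIdempotentElem e) : e * coKerProj e = e := by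
  rw [coKerProj, ← mul_assoc, mul_inverse_mul he]

theorem isStarProjection_rangeProj (he : IsIdempotentElem e) :
    IsStarProjection (rangeProj e) where
  isIdempotentElem := by
    rw [IsIdempotentElem]
    nth_rw 2 [rangeProj]
    rw [← mul_assoc, rangeProj_mul he, rangeProj]
  isSelfAdjoint := star_rangeProj he

theorem isStarProjection_coKerProj (he : IsIdempotentElem e) :
    IsStarProjection (coKerProj e) where
  isIdempotentElem := by
    rw [IsIdempotentElem]
    nth_rw 1 [coKerProj]
    rw [mul_assoc, mul_coKerProj he, coKerProj]
  isSelfAdjoint := star_coKerProj he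

theorem norm_mul_one_sub_le (he : IsIdempotentElem e) :
    ‖e‖ * (1 - ‖rangeProj e - coKerProj e‖) ≤ 1 := by
  have h : e = rangeProj e - e * (rangeProj e - coKerProj e) := by
    rw [mul_sub, mul_rangeProj he, mul_coKerProj he, sub_sub_cancel]
  have h₁ : ‖e‖ ≤ ‖rangeProj e‖ + ‖e‖ * ‖rangeProj e - coKerProj e‖ := by
    conv_lhs => rw [h]
    exact (norm_sub_le _ _).trans (by gcongr; exact norm_mul_le _ _)
  have h₂ := (isStarProjection_rangeProj he).norm_le
  linarith

/-- A bound on an idempotent separates its range from the orthogonal complement of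
its kernel. -/
theorem norm_rangeProj_sub_coKerProj_sq_le (he : IsIdempotentElem e) {K : ℝ}
    (h : ‖(e + star e - 1) * (e + star e - 1)‖ ≤ K) :
    ‖rangeProj e - coKerProj e‖ ^ 2 ≤ max 0 (1 - K⁻¹) := by
  rcases subsingleton_or_nontrivial A with hA | hA
  · simp [Subsingleton.elim (rangeProj e - coKerProj e) 0]
  set p := rangeProj e
  set q := coKerProj e
  set u := e + star e - 1
  set w := p + q - 1 with hw
  have hp := isStarProjection_rangeProj he
  have hq := isStarProjection_coKerProj he
  have hpp : p * p = p := hp.isIdempotentElem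
  have hqq : q * q = q := hq.isIdempotentElem
  have hwsa : star w = w := by
    simp only [hw, star_sub, star_add, star_one, p, q, star_rangeProj he, star_coKerProj he]
  have husa : star u = u := by simp [u, add_comm]
  have hpe : p * star e = p := by
    simpa [star_rangeProj he] using congrArg star (mul_rangeProj he)
  have hqe : q * star e = star e := by
    simpa [star_coKerProj he] using congrArg star (mul_coKerProj he)
  have hwu : w * u = 1 := by
    simp only [hw, u, mul_sub, sub_mul, mul_add, add_mul, mul_one, one_mul, hpe, hqe,
      p, q, rangeProj_mul he, coKerProj_mul he]
    abel
  have huw : u * w = 1 := by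
    have := congrArg star hwu
    rwa [star_mul, hwsa, husa, star_one] at this
  have hdsa : IsSelfAdjoint (p - q) := hp.isSelfAdjoint.sub hq.isSelfAdjoint
  have hsq : (p - q) ^ 2 = 1 - star w * w := by
    rw [hwsa]
    simp only [hw, sq, mul_sub, sub_mul, mul_add, add_mul, mul_one, one_mul, hpp, hqq]
    abel
  have hnorm : ‖(p - q) ^ 2‖ = ‖p - q‖ ^ 2 := by
    rw [sq, sq, ← CStarRing.norm_star_mul_self, hdsa.star_eq]
  let := CStarAlgebra.spectralOrder A
  let := CStarAlgebra.spectralOrderedRing A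
  have hmem : ‖p - q‖ ^ 2 ∈ spectrum ℝ ((p - q) ^ 2) := by
    rw [← hnorm]
    exact CStarAlgebra.norm_mem_spectrum_of_nonneg hdsa.sq_nonneg
  have hmem' : 1 - ‖p - q‖ ^ 2 ∈ spectrum ℝ (star w * w) := by
    rw [hsq, ← map_one (algebraMap ℝ A), ← spectrum.singleton_sub_eq] at hmem
    obtain ⟨_, rfl, t, ht, h'⟩ := hmem
    simpa [← h'] using ht
  have hnn := spectrum_star_mul_self_nonneg _ hmem'
  let v : Aˣ := ⟨star w * w, u * u, by rw [hwsa, mul_assoc, ← mul_assoc w u, hwu, one_mul, hwu],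
    by rw [hwsa, mul_assoc, ← mul_assoc u w, huw, one_mul, huw]⟩
  have hne : 1 - ‖p - q‖ ^ 2 ≠ 0 := spectrum.ne_zero_of_mem_of_unit (a := v) hmem'
  have hinv : (1 - ‖p - q‖ ^ 2)⁻¹ ∈ spectrum ℝ (u * u) :=
    spectrum.inv₀_mem_iff (a := v⁻¹) |>.2 hmem'
  have hle := (Real.le_norm_self _).trans ((spectrum.norm_le_norm_of_mem hinv).trans h)
  have := inv_le_of_inv_le₀ (hnn.lt_of_ne' hne) hle
  exact le_max_of_le_right (by linarith)

theorem IsGroupInv.mul_coKerProj {a x : A} (h : IsGroupInv a x) :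
    a * coKerProj (a * x) = a := by
  have hae : a * (a * x) = a := by rw [h.2.2, ← mul_assoc, h.1]
  calc a * coKerProj (a * x) = a * (a * x) * coKerProj (a * x) := by rw [hae]
    _ = a := by rw [mul_assoc, _root_.mul_coKerProj h.isIdempotentElem, hae]

theorem IsGroupInv.rangeProj_mul {a x : A} (h : IsGroupInv a x) :
    rangeProj (a * x) * a = a := by
  calc rangeProj (a * x) * a = rangeProj (a * x) * (a * x * a) := by rw [h.1]
    _ = a := by rw [← mul_assoc, _root_.rangeProj_mul h.isIdempotentElem, h.1]

theorem IsGroupInv.isMPInv {a x : A} (h : IsGroupInv a x) :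
    IsMPInv a (coKerProj (a * x) * x * rangeProj (a * x)) := by
  have he := h.isIdempotentElem
  have hl : a * (coKerProj (a * x) * x * rangeProj (a * x)) = rangeProj (a * x) := by
    rw [← mul_assoc, ← mul_assoc, h.mul_coKerProj, mul_rangeProj he]
  have hr : coKerProj (a * x) * x * rangeProj (a * x) * a = coKerProj (a * x) := by
    rw [mul_assoc, h.rangeProj_mul, mul_assoc, ← h.2.2, coKerProj_mul he]
  refine ⟨by rw [hl, h.rangeProj_mul], ?_, by rw [hl, star_rangeProj he],
    by rw [hr, star_coKerProj he]⟩
  rw [hr, ← mul_assoc, ← mul_assoc, (isStarProjection_coKerProj he).isIdempotentElem.eq]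

theorem IsGroupInv.mpInv_eq {a x : A} (h : IsGroupInv a x) :
    mpInv a = coKerProj (a * x) * x * rangeProj (a * x) :=
  h.isMPInv.mpInv_eq

theorem IsGroupInv.mul_mpInv_sub_mpInv_mul {a x : A} (h : IsGroupInv a x) :
    a * mpInv a - mpInv a * a = rangeProj (a * x) - coKerProj (a * x) := by
  have he := h.isIdempotentElem
  rw [h.mpInv_eq, ← mul_assoc, ← mul_assoc, h.mul_coKerProj, mul_rangeProj he,
    mul_assoc _ _ a, h.rangeProj_mul, mul_assoc _ x a, ← h.2.2, coKerProj_mul he]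

theorem IsGroupInv.eq_mul_mpInv_mul {a x : A} (h : IsGroupInv a x) :
    x = a * x * mpInv a * (a * x) := by
  have he := h.isIdempotentElem
  have hex : a * x * x = x := by rw [h.2.2, h.2.1]
  have hxe : x * (a * x) = x := by rw [← mul_assoc, h.2.1]
  rw [h.mpInv_eq, mul_assoc (a * x), mul_assoc _ (rangeProj _), _root_.rangeProj_mul he,
    mul_assoc _ x (a * x), hxe, ← mul_assoc, _root_.mul_coKerProj he, hex]

theorem tendsto_inverse_add_star_sub_one {ι : Type*} {l : Filter ι} {f : ι → A} {e : A}
    (he : IsIdempotentElem e) (hf : Tendsto f l (𝓝 e)) :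
    Tendsto (fun i => Ring.inverse (f i + star (f i) - 1)) l
      (𝓝 (Ring.inverse (e + star e - 1))) := by
  obtain ⟨u, hu⟩ := isUnit_add_star_sub_one he
  have h := NormedRing.inverse_continuousAt u
  rw [hu] at h
  exact h.tendsto.comp ((hf.add hf.star).sub_const 1)

/-- If the idempotents `s n * x n` are bounded in norm, the maximal angles of the `s n` are
bounded away from `π / 2`. -/
theorem exists_maxAngle_le {ι : Type*} {s x : ι → A} (h : ∀ n, IsGroupInv (s n) (x n)) {C : ℝ}
    (hC : ∀ n, ‖s n * x n‖ ≤ C) :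
    ∃ ψ, 0 ≤ ψ ∧ ψ < Real.pi / 2 ∧ ∀ n, maxAngle (s n) ≤ ψ := by
  set L : ℝ := |C| + |C| + ‖(1 : A)‖ + 1
  have hL : 0 < L := by positivity
  set c : ℝ := √(max 0 (1 - (L * L)⁻¹))
  have hc : c < 1 := by
    rw [Real.sqrt_lt' one_pos, one_pow, max_lt_iff]
    exact ⟨one_pos, sub_lt_self _ (by positivity)⟩
  refine ⟨Real.arcsin c, Real.arcsin_nonneg.2 (Real.sqrt_nonneg _), Real.arcsin_lt_pi_div_two.2 hc,
    fun n => Real.monotone_arcsin ?_⟩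
  rw [(h n).mul_mpInv_sub_mpInv_mul]
  apply Real.le_sqrt_of_sq_le
  apply norm_rangeProj_sub_coKerProj_sq_le (h n).isIdempotentElem
  have hu : ‖s n * x n + star (s n * x n) - 1‖ ≤ L := by
    have h₁ := norm_sub_le (s n * x n + star (s n * x n)) 1
    have h₂ := norm_add_le (s n * x n) (star (s n * x n))
    rw [norm_star] at h₂
    have h₃ := (hC n).trans (le_abs_self C)
    linarith
  exact (norm_mul_le _ _).trans (by gcongr)

theorem norm_le_of_maxAngle_le {a x : A} (h : IsGroupInv a x) {ψ : ℝ} (h₀ : 0 ≤ ψ)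
    (hψ : ψ < Real.pi / 2) (ha : maxAngle a ≤ ψ) : ‖a * x‖ ≤ (1 - Real.sin ψ)⁻¹ := by
  have hsin : Real.sin ψ < 1 := by
    rw [← Real.sin_pi_div_two]
    exact Real.sin_lt_sin_of_lt_of_le_pi_div_two (by linarith) le_rfl hψ
  have hd := (Real.arcsin_le_iff_le_sin' ⟨by linarith, hψ⟩).1 ha
  rw [h.mul_mpInv_sub_mpInv_mul] at hd
  have hpos : 0 < 1 - Real.sin ψ := by linarith
  rw [← one_div, le_div_iff₀ hpos]
  refine le_trans ?_ (norm_mul_one_sub_le h.isIdempotentElem)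
  gcongr

/-- A bounded sequence of group inverses of the terms of a convergent sequence converges to
a group inverse of the limit. -/
theorem exists_isGroupInv_tendsto {a : A} {s x : ℕ → A} (h : ∀ n, IsGroupInv (s n) (x n))
    (hs : Tendsto s atTop (𝓝 a)) {C : ℝ} (hC : ∀ n, ‖x n‖ ≤ C) :
    ∃ y, IsGroupInv a y ∧ Tendsto x atTop (𝓝 y) := by
  obtain ⟨D, hD⟩ := hs.norm.bddAbove_range
  replace hD : ∀ n, ‖s n‖ ≤ D := fun n => hD ⟨n, rfl⟩
  have hC₀ : 0 ≤ C := (norm_nonneg _).trans (hC 0)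
  have hD₀ : 0 ≤ D := (norm_nonneg _).trans (hD 0)
  set M : ℝ := C * C * (‖(1 : A)‖ + D * C) + (‖(1 : A)‖ + D * C) * (C * C) + C * C with hM
  have hM₀ : 0 ≤ M := by positivity
  have hlip : ∀ m n, ‖x n - x m‖ ≤ M * ‖s n - s m‖ := by
    intro m n
    have he : ∀ k, ‖1 - s k * x k‖ ≤ ‖(1 : A)‖ + D * C := fun k =>
      (norm_sub_le _ _).trans (by
        gcongr
        exact norm_mul_le_of_le (hD k) (hC k))
    have hxx : ∀ k, ‖x k * x k‖ ≤ C * C := fun k => norm_mul_le_of_le (hC k) (hC k)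
    rw [(h m).sub_eq (h n)]
    calc _ ≤ C * C * ‖s n - s m‖ * (‖(1 : A)‖ + D * C)
          + (‖(1 : A)‖ + D * C) * ‖s n - s m‖ * (C * C) + C * ‖s n - s m‖ * C :=
        norm_sub_le_of_le
          (norm_add_le_of_le
            (norm_mul_le_of_le (norm_mul_le_of_le (hxx n) le_rfl) (he m))
            (norm_mul_le_of_le (norm_mul_le_of_le (he n) le_rfl) (hxx m)))
          (norm_mul_le_of_le (norm_mul_le_of_le (hC n) le_rfl) (hC m))
      _ = M * ‖s n - s m‖ := by rw [hM]; ring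
  have hcauchy : CauchySeq x := by
    rw [Metric.cauchySeq_iff]
    intro ε hε
    obtain ⟨N, hN⟩ := Metric.cauchySeq_iff.1 hs.cauchySeq (ε / (M + 1)) (by positivity)
    refine ⟨N, fun m hm n hn => ?_⟩
    have hlt := hN m hm n hn
    rw [dist_eq_norm, lt_div_iff₀ (by positivity)] at hlt
    rw [dist_eq_norm]
    have := hlip n m
    nlinarith [norm_nonneg (s m - s n)]
  obtain ⟨y, hy⟩ := cauchySeq_tendsto_of_complete hcauchy
  refine ⟨y, ⟨?_, ?_, ?_⟩, hy⟩
  · exact tendsto_nhds_unique (((hs.mul hy).mul hs).congr fun n => (h n).1) hs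
  · exact tendsto_nhds_unique (((hy.mul hs).mul hy).congr fun n => (h n).2.1) hy
  · exact tendsto_nhds_unique ((hs.mul hy).congr fun n => (h n).2.2) (hy.mul hs)

theorem IsGroupInv.tendsto_mpInv {a y : A} {s x : ℕ → A} (h : ∀ n, IsGroupInv (s n) (x n))
    (ha : IsGroupInv a y) (hs : Tendsto s atTop (𝓝 a)) (hx : Tendsto x atTop (𝓝 y)) :
    Tendsto (fun n => mpInv (s n)) atTop (𝓝 (mpInv a)) := by
  have he := hs.mul hx
  have hu := tendsto_inverse_add_star_sub_one ha.isIdempotentElem he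
  rw [ha.mpInv_eq]
  exact (((hu.mul he).mul hx).mul (he.mul hu)).congr fun n => (h n).mpInv_eq.symm

theorem tfae_tendsto_groupInv (a : A) (s : ℕ → A) (hs : ∀ n, ∃ x, IsGroupInv (s n) x)
    (hconv : Tendsto s atTop (𝓝 a)) :
    List.TFAE
      [(∃ x, IsGroupInv a x) ∧ Tendsto (fun n => groupInv (s n)) atTop (𝓝 (groupInv a)),
       ∃ C, ∀ n, ‖groupInv (s n)‖ ≤ C,
       (∃ x, IsMPInv a x) ∧ Tendsto (fun n => mpInv (s n)) atTop (𝓝 (mpInv a)) ∧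
         ∃ C, ∀ n, ‖groupInv (s n) * s n‖ ≤ C,
       (∃ x, IsMPInv a x) ∧ Tendsto (fun n => mpInv (s n)) atTop (𝓝 (mpInv a)) ∧
         ∃ ψ, 0 ≤ ψ ∧ ψ < Real.pi / 2 ∧ ∀ n, maxAngle (s n) ≤ ψ] := by
  have h n := groupInv_spec (hs n)
  have hcomm n : s n * groupInv (s n) = groupInv (s n) * s n := (h n).2.2
  tfae_have 1 → 3 := by
    rintro ⟨ha, hx⟩
    have ha := groupInv_spec ha
    obtain ⟨C, hC⟩ := (hx.mul hconv).norm.bddAbove_range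
    exact ⟨⟨_, ha.isMPInv⟩, ha.tendsto_mpInv h hconv hx, C, fun n => hC ⟨n, rfl⟩⟩
  tfae_have 2 → 1 := by
    rintro ⟨C, hC⟩
    obtain ⟨y, hy, hlim⟩ := exists_isGroupInv_tendsto h hconv hC
    exact ⟨⟨y, hy⟩, hy.groupInv_eq ▸ hlim⟩
  tfae_have 3 → 4 := by
    rintro ⟨ha, hlim, C, hC⟩
    exact ⟨ha, hlim, exists_maxAngle_le h fun n => (hcomm n) ▸ hC n⟩
  tfae_have 4 → 2 := by
    rintro ⟨-, hlim, ψ, h₀, hψ, hle⟩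
    obtain ⟨D, hD⟩ := hlim.norm.bddAbove_range
    refine ⟨(1 - Real.sin ψ)⁻¹ * D * (1 - Real.sin ψ)⁻¹, fun n => ?_⟩
    have he := norm_le_of_maxAngle_le (h n) h₀ hψ (hle n)
    rw [(h n).eq_mul_mpInv_mul]
    exact norm_mul_le_of_le (norm_mul_le_of_le he (hD ⟨n, rfl⟩)) he
  tfae_finish

end Projections

theorem stmt6 {A : Type*} [NormedRing A] [StarRing A] [CStarRing A]
    [CompleteSpace A] [NormedAlgebra ℂ A] [StarModule ℂ A]
    (a : A) (s : ℕ → A) (hs : ∀ n, ∃ x, IsGroupInv (s n) x)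
    (hconv : Filter.Tendsto s Filter.atTop (nhds a)) :
    List.TFAE
      [(∃ x, IsGroupInv a x) ∧
         Filter.Tendsto (fun n => groupInv (s n)) Filter.atTop (nhds (groupInv a)),
       ∃ C, ∀ n, ‖groupInv (s n)‖ ≤ C,
       (∃ x, IsMPInv a x) ∧
         Filter.Tendsto (fun n => mpInv (s n)) Filter.atTop (nhds (mpInv a)) ∧
         ∃ C, ∀ n, ‖groupInv (s n) * s n‖ ≤ C,
       (∃ x, IsMPInv a x) ∧
         Filter.Tendsto (fun n => mpInv (s n)) Filter.atTop (nhds (mpInv a)) ∧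
         ∃ ψ, 0 ≤ ψ ∧ ψ < Real.pi / 2 ∧ ∀ n, maxAngle (s n) ≤ ψ] := by
  let : CStarAlgebra A := { }
  exact tfae_tendsto_groupInv a s hs hconv
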